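/- arXiv:2604.26490 — 9 statements merged into one kernel-verified Lean document; each statement's English description precedes it below -/
import Mathlib

section
/- Let 1 ≤ k < n and let X ⊆ ℝⁿ = ℝ^k × ℝ^{n−k} be a closed set with 0 ∈ X. Then the following are equivalent: (i) C₀X ∩ ({0}^k × ℝ^{n−k}) = {0}; (ii) there exist a constant C > 0 and a neighbourhood U of 0 in ℝⁿ such that X ∩ U ⊆ {(x, y) ∈ ℝ^k × ℝ^{n−k} : ‖y‖ ≤ C‖x‖}. -/
open Filter Topology Metric
open scoped ENNReal

noncomputable section

/-- The set of nearest points of `X` to `a`. -/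
def nearestPts {E : Type*} [NormedAddCommGroup E] (X : Set E) (a : E) : Set E :=
  {x | x ∈ X ∧ dist a x = Metric.infDist a X}

/-- The Peano tangent cone of `S` at `a`. -/
def peanoCone {E : Type*} [NormedAddCommGroup E] [NormedSpace ℝ E] (S : Set E) (a : E) :
    Set E :=
  {v | ∃ (x : ℕ → E) (l : ℕ → ℝ), (∀ ν, x ν ∈ S) ∧ Tendsto x atTop (𝓝 a) ∧
    (∀ ν, 0 < l ν) ∧ Tendsto (fun ν => l ν • (x ν - a)) atTop (𝓝 v)}

/-- ℝⁿ = ℝ^k × ℝ^{n-k} with the Euclidean (ℓ²) norm. -/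
abbrev Amb (k m : ℕ) := WithLp 2 (EuclideanSpace ℝ (Fin k) × EuclideanSpace ℝ (Fin m))

/-- First (horizontal) component of a point of ℝ^k × ℝ^{n-k}. -/
def hor {k m : ℕ} (p : Amb k m) : EuclideanSpace ℝ (Fin k) := (WithLp.equiv 2 _ p).1

/-- Second (vertical) component of a point of ℝ^k × ℝ^{n-k}. -/
def ver {k m : ℕ} (p : Amb k m) : EuclideanSpace ℝ (Fin m) := (WithLp.equiv 2 _ p).2

theorem hor_smul {k m : ℕ} (c : ℝ) (p : Amb k m) : hor (c • p) = c • hor p := rfl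

theorem ver_smul {k m : ℕ} (c : ℝ) (p : Amb k m) : ver (c • p) = c • ver p := rfl

theorem continuous_hor {k m : ℕ} : Continuous (hor : Amb k m → _) :=
  continuous_fst.comp (WithLp.prod_continuous_ofLp 2 _ _)

theorem continuous_ver {k m : ℕ} : Continuous (ver : Amb k m → _) :=
  continuous_snd.comp (WithLp.prod_continuous_ofLp 2 _ _)

theorem eq_zero_of_hor_of_ver {k m : ℕ} {p : Amb k m} (hh : hor p = 0) (hv : ver p = 0) :
    p = 0 :=
  (WithLp.equiv 2 _).injective (Prod.ext hh hv)

theorem norm_ver_le {k m : ℕ} (p : Amb k m) : ‖ver p‖ ≤ ‖p‖ :=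
  WithLp.norm_snd_le _ p

theorem zero_mem_peanoCone {E : Type*} [NormedAddCommGroup E] [NormedSpace ℝ E] {S : Set E}
    {a : E} (ha : a ∈ S) : (0 : E) ∈ peanoCone S a :=
  ⟨fun _ => a, fun _ => 1, fun _ => ha, tendsto_const_nhds, fun _ => one_pos, by simp⟩

/-- A sequence in `S` converging to `a` and avoiding `a` has a subsequence whose directions
converge to a unit vector of the Peano tangent cone. -/
theorem exists_unit_mem_peanoCone {E : Type*} [NormedAddCommGroup E] [NormedSpace ℝ E]
    [ProperSpace E] {S : Set E} {a : E} {x : ℕ → E} (hxS : ∀ ν, x ν ∈ S)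
    (hx : Tendsto x atTop (𝓝 a)) (hne : ∀ ν, x ν ≠ a) :
    ∃ v ∈ peanoCone S a, ‖v‖ = 1 ∧ ∃ φ : ℕ → ℕ, StrictMono φ ∧
      Tendsto (fun ν => ‖x (φ ν) - a‖⁻¹ • (x (φ ν) - a)) atTop (𝓝 v) := by
  have hpos ν : 0 < ‖x ν - a‖ := norm_pos_iff.2 (sub_ne_zero.2 (hne ν))
  have hmem ν : ‖x ν - a‖⁻¹ • (x ν - a) ∈ sphere (0 : E) 1 := by
    rw [mem_sphere_zero_iff_norm, norm_smul, norm_inv, norm_norm, inv_mul_cancel₀ (hpos ν).ne']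
  obtain ⟨v, hv, φ, hφ, hlim⟩ := (isCompact_sphere (0 : E) 1).tendsto_subseq hmem
  exact ⟨v, ⟨x ∘ φ, fun ν => ‖x (φ ν) - a‖⁻¹, fun ν => hxS _, hx.comp hφ.tendsto_atTop,
    fun ν => inv_pos.2 (hpos _), hlim⟩, mem_sphere_zero_iff_norm.1 hv, φ, hφ, hlim⟩

theorem norm_ver_le_of_mem_peanoCone {k m : ℕ} {X U : Set (Amb k m)} {C : ℝ}
    (hU : U ∈ 𝓝 (0 : Amb k m)) (hXU : X ∩ U ⊆ {p | ‖ver p‖ ≤ C * ‖hor p‖})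
    {v : Amb k m} (hv : v ∈ peanoCone X 0) : ‖ver v‖ ≤ C * ‖hor v‖ := by
  obtain ⟨x, l, hxX, hx, hl, hlim⟩ := hv
  simp only [sub_zero] at hlim
  refine le_of_tendsto_of_tendsto ((continuous_ver.norm.tendsto v).comp hlim)
    (((continuous_hor.norm.tendsto v).comp hlim).const_mul C) ?_
  filter_upwards [hx.eventually_mem hU] with ν hν
  have h : ‖ver (x ν)‖ ≤ C * ‖hor (x ν)‖ := hXU ⟨hxX ν, hν⟩
  simp only [Function.comp_apply, hor_smul, ver_smul, norm_smul]
  rw [mul_left_comm]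
  gcongr

theorem exists_horizontal_cone {k m : ℕ} {X : Set (Amb k m)}
    (h : peanoCone X 0 ∩ {p | hor p = 0} ⊆ {0}) :
    ∃ C > (0 : ℝ), ∃ U ∈ 𝓝 (0 : Amb k m), X ∩ U ⊆ {p | ‖ver p‖ ≤ C * ‖hor p‖} := by
  by_contra! hcon
  have hex (N : ℕ) : ∃ p ∈ X, p ∈ ball (0 : Amb k m) (1 / ((N : ℝ) + 1)) ∧
      ((N : ℝ) + 1) * ‖hor p‖ < ‖ver p‖ := by
    obtain ⟨p, ⟨hpX, hpU⟩, hp⟩ := Set.not_subset.1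
      (hcon ((N : ℝ) + 1) (by positivity) _ (ball_mem_nhds 0 Nat.one_div_pos_of_nat))
    exact ⟨p, hpX, hpU, not_le.1 hp⟩
  choose x hxX hxU hxC using hex
  have hx : Tendsto x atTop (𝓝 0) := tendsto_iff_dist_tendsto_zero.2
    (squeeze_zero (fun _ => dist_nonneg) (fun N => (hxU N).le)
      tendsto_one_div_add_atTop_nhds_zero_nat)
  have hne N : x N ≠ 0 := by
    intro h0
    have hver : 0 < ‖ver (x N)‖ := lt_of_le_of_lt (by positivity) (hxC N)
    have := norm_ver_le (x N)
    rw [h0, norm_zero] at this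
    rw [h0] at hver
    exact hver.not_ge this
  obtain ⟨v, hv, hv1, φ, hφ, hlim⟩ := exists_unit_mem_peanoCone hxX hx hne
  simp only [sub_zero] at hlim
  have hbound N : ‖hor (‖x N‖⁻¹ • x N)‖ ≤ 1 / ((N : ℝ) + 1) := by
    have hpos : 0 < ‖x N‖ := norm_pos_iff.2 (hne N)
    rw [hor_smul, norm_smul, norm_inv, norm_norm, le_div_iff₀ (by positivity), mul_assoc,
      inv_mul_le_iff₀ hpos, mul_one, mul_comm]
    exact (hxC N).le.trans (norm_ver_le _)
  have hhor : hor v = 0 := by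
    refine tendsto_nhds_unique ((continuous_hor.tendsto v).comp hlim)
      (squeeze_zero_norm (fun N => hbound (φ N)) ?_)
    exact tendsto_one_div_add_atTop_nhds_zero_nat.comp hφ.tendsto_atTop
  have hv0 : v = 0 := h ⟨hv, hhor⟩
  simp [hv0] at hv1

/-- for a closed set `X ⊆ ℝ^k × ℝ^{n-k}` containing the origin,
the Peano tangent cone at `0` meets `{0}^k × ℝ^{n-k}` only at `0` if and only if
near the origin `X` lies in a horizontal cone `{‖y‖ ≤ C‖x‖}`. -/
theorem stmt0 (n k : ℕ) (hk : 1 ≤ k) (hkn : k < n)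
    (X : Set (Amb k (n - k))) (hX : IsClosed X) (h0 : (0 : Amb k (n - k)) ∈ X) :
    peanoCone X 0 ∩ {p : Amb k (n - k) | hor p = 0} = {0} ↔
      ∃ C > (0 : ℝ), ∃ U ∈ 𝓝 (0 : Amb k (n - k)),
        X ∩ U ⊆ {p : Amb k (n - k) | ‖ver p‖ ≤ C * ‖hor p‖} := by
  refine ⟨fun h => exists_horizontal_cone h.subset, ?_⟩
  rintro ⟨C, -, U, hU, hXU⟩
  refine Set.Subset.antisymm ?_ (Set.singleton_subset_iff.2 ⟨zero_mem_peanoCone h0, rfl⟩)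
  rintro v ⟨hv, hhor : hor v = 0⟩
  have hver := norm_ver_le_of_mem_peanoCone hU hXU hv
  rw [hhor, norm_zero, mul_zero] at hver
  exact eq_zero_of_hor_of_ver hhor (norm_le_zero_iff.1 hver)
end
end

section
/- Let X ⊆ ℝⁿ be a nonempty proper closed set, let a ∈ X and let v ∈ V_a(X) be a unit normal direction. If the directional reaching radius vanishes, r_v(a) = 0 (equivalently, a ∉ m(a + tv) for every t > 0), then a ∈ closure(M_X) and v belongs to the Peano tangent cone C_a(closure(M_X)) of closure(M_X) at a. -/
open Filter Topology Metric

noncomputable section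

local notation "⟪" x ", " y "⟫" => @inner ℝ _ _ x y

/-- The medial axis of `X`: points with at least two nearest points in `X`. -/
def medialAxis {E : Type*} [NormedAddCommGroup E] (X : Set E) : Set E :=
  {a | ∃ x ∈ nearestPts X a, ∃ y ∈ nearestPts X a, x ≠ y}

section Auxiliary

variable {E : Type*} [NormedAddCommGroup E] [InnerProductSpace ℝ E]

/-- Away from the medial axis, the distance function has ascending slope `1`. -/
theorem exists_infDist_gt_of_notMem_medialAxis [ProperSpace E] {X : Set E} (hX : IsClosed X)
    (hne : X.Nonempty) {q : E} (hq : 0 < infDist q X) (hM : q ∉ medialAxis X) {c : ℝ}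
    (hc0 : 0 < c) (hc : c < 1) {ρ : ℝ} (hρ : 0 < ρ) :
    ∃ q', dist q' q < ρ ∧ infDist q X + c * dist q' q < infDist q' X := by
  by_contra! H
  obtain ⟨x, hxX, hx⟩ := hX.exists_infDist_eq_dist hne q
  set D := infDist q X with hD
  have hnx : ‖q - x‖ = D := by rw [hx, dist_eq_norm]
  set u : E := D⁻¹ • (q - x) with hu
  have hnu : ‖u‖ = 1 := by
    rw [hu, norm_smul, hnx, Real.norm_of_nonneg (by positivity), inv_mul_cancel₀ hq.ne']
  obtain ⟨h, -, hh, hlim⟩ := exists_seq_strictAnti_tendsto' hρ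
  have hdq : ∀ k, dist (q + h k • u) q = h k := fun k => by
    rw [dist_eq_norm, add_sub_cancel_left, norm_smul, hnu, mul_one,
      Real.norm_of_nonneg (hh k).1.le]
  choose y hyX hy using fun k => hX.exists_infDist_eq_dist hne (q + h k • u)
  have hle : ∀ k, dist (q + h k • u) (y k) ≤ D + c * h k := fun k => by
    have := H (q + h k • u) (by rw [hdq]; exact (hh k).2)
    rwa [hdq, hy] at this
  have hqy : ∀ k, dist (y k) q ≤ D + 2 * h k := fun k => by
    have h1 := dist_triangle_left (y k) q (q + h k • u)
    rw [hdq] at h1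
    nlinarith [hle k, (hh k).1]
  obtain ⟨z, -, φ, hφ, hz⟩ := (isCompact_closedBall q (D + 2 * ρ)).tendsto_subseq
    (x := y) fun k => mem_closedBall.2 ((hqy k).trans (by linarith [(hh k).2]))
  have hhφ : Tendsto (fun k => h (φ k)) atTop (𝓝 0) := hlim.comp hφ.tendsto_atTop
  have hzX : z ∈ X := hX.mem_of_tendsto hz (Eventually.of_forall fun k => hyX _)
  have hzD : dist z q ≤ D := by
    have h2 : Tendsto (fun k => D + 2 * h (φ k)) atTop (𝓝 (D + 2 * 0)) :=
      (hhφ.const_mul 2).const_add D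
    have := le_of_tendsto_of_tendsto' (hz.dist tendsto_const_nhds) h2 fun k => hqy (φ k)
    simpa using this
  have hzx : z = x := by
    by_contra hzx
    refine hM ⟨z, ⟨hzX, le_antisymm ?_ (infDist_le_dist_of_mem hzX)⟩, x, ⟨hxX, hx.symm⟩, hzx⟩
    rwa [dist_comm]
  subst hzx
  have key : ∀ k, 2 * inner ℝ u (q - y k) + h k ≤ 2 * c * D + c ^ 2 * h k := fun k => by
    have h1 : ‖q + h k • u - y k‖ ^ 2 = ‖q - y k‖ ^ 2 + 2 * (h k * inner ℝ u (q - y k)) + h k ^ 2 := by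
      rw [show q + h k • u - y k = (q - y k) + h k • u by abel, norm_add_sq_real,
        inner_smul_right, real_inner_comm, norm_smul, hnu, mul_one, Real.norm_eq_abs, sq_abs]
    have h2 : ‖q + h k • u - y k‖ ^ 2 ≤ (D + c * h k) ^ 2 := by
      have := hle k
      rw [dist_eq_norm] at this
      gcongr
    have h3 : D ^ 2 ≤ ‖q - y k‖ ^ 2 := by
      have := infDist_le_dist_of_mem (x := q) (hyX k)
      rw [dist_eq_norm] at this
      gcongr
    have h4 := (hh k).1
    refine le_of_mul_le_mul_left ?_ h4
    nlinarith
  have hl1 : Tendsto (fun k => 2 * inner ℝ u (q - y (φ k)) + h (φ k)) atTop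
      (𝓝 (2 * inner ℝ u (q - z) + 0)) :=
    ((tendsto_const_nhds.inner (tendsto_const_nhds.sub hz)).const_mul 2).add hhφ
  have hl2 : Tendsto (fun k => 2 * c * D + c ^ 2 * h (φ k)) atTop
      (𝓝 (2 * c * D + c ^ 2 * 0)) := (hhφ.const_mul _).const_add _
  have hfin := le_of_tendsto_of_tendsto' hl1 hl2 fun k => key (φ k)
  have hin : inner ℝ u (q - z) = D := by
    rw [hu, real_inner_smul_left, real_inner_self_eq_norm_sq, hnx]
    field_simp
  rw [hin] at hfin
  nlinarith

/-- If the medial axis misses a ball, the distance function grows at full speed from its centre. -/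
theorem exists_infDist_eq_add [ProperSpace E] {X : Set E} (hX : IsClosed X)
    (hne : X.Nonempty) {p : E} (hp : 0 < infDist p X) {r : ℝ} (hr : 0 < r)
    (hM : Disjoint (ball p r) (medialAxis X)) :
    ∃ q, dist q p ≤ r ∧ infDist p X + r ≤ infDist q X := by
  have hcomp := isCompact_closedBall p r
  have hcont : Continuous fun q => infDist q X := continuous_infDist_pt X
  obtain ⟨q, hq, hmax⟩ := hcomp.exists_isMaxOn ⟨p, mem_closedBall_self hr.le⟩ hcont.continuousOn
  refine ⟨q, hq, ?_⟩
  have hc : ∀ c : ℝ, 0 < c → c < 1 → infDist p X + c * r ≤ infDist q X := by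
    intro c hc0 hc1
    obtain ⟨w, hw, hwmax⟩ := hcomp.exists_isMaxOn (f := fun q => infDist q X - c * dist q p)
      ⟨p, mem_closedBall_self hr.le⟩ (by fun_prop)
    have hwp : infDist p X + c * dist w p ≤ infDist w X := by
      have : infDist p X - c * dist p p ≤ infDist w X - c * dist w p :=
        hwmax (mem_closedBall_self hr.le)
      rw [dist_self] at this
      linarith
    have hwr : dist w p = r := by
      refine le_antisymm hw (not_lt.1 fun hlt => ?_)
      have hw0 : 0 < infDist w X := by nlinarith [dist_nonneg (x := w) (y := p)]
      obtain ⟨q', hq'1, hq'2⟩ := exists_infDist_gt_of_notMem_medialAxis hX hne hw0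
        (Set.disjoint_left.1 hM (mem_ball.2 hlt)) hc0 hc1 (sub_pos.2 hlt)
      have htri := dist_triangle q' w p
      have : infDist q' X - c * dist q' p ≤ infDist w X - c * dist w p :=
        hwmax (mem_closedBall.2 (by linarith))
      nlinarith
    have : infDist w X ≤ infDist q X := hmax hw
    rw [hwr] at hwp
    linarith
  have hl : Tendsto (fun c : ℝ => infDist p X + c * r) (𝓝[<] 1) (𝓝 (infDist p X + 1 * r)) :=
    ((continuous_const.add (continuous_id.mul continuous_const)).tendsto (1 : ℝ)).mono_left
      nhdsWithin_le_nhds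
  rw [one_mul] at hl
  refine le_of_tendsto hl ?_
  filter_upwards [Ioo_mem_nhdsLT (zero_lt_one' ℝ)] with c hc'
  exact hc c hc'.1 hc'.2

/-- Off the medial axis, a nearest point stays nearest further along the normal segment. -/
theorem infDist_add_smul_of_disjoint [ProperSpace E] {X : Set E} (hX : IsClosed X)
    {x u : E} (hx : x ∈ X) (hu : ‖u‖ = 1) {s r : ℝ} (hs : 0 < s) (hr : 0 < r)
    (hd : infDist (x + s • u) X = s) (hM : Disjoint (ball (x + s • u) r) (medialAxis X)) :
    infDist (x + (s + r) • u) X = s + r := by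
  obtain ⟨q, hq, hqd⟩ := exists_infDist_eq_add hX ⟨x, hx⟩ (hd.symm ▸ hs) hr hM
  rw [hd] at hqd
  have h1 : s + r ≤ ‖q - x‖ := by
    rw [← dist_eq_norm]
    exact hqd.trans (infDist_le_dist_of_mem hx)
  rw [dist_eq_norm] at hq
  have h2 : q = x + (s + r) • u := by
    set e := q - (x + s • u) with he
    have hqx : q - x = s • u + e := by rw [he]; abel
    have hsq : ‖q - x‖ ^ 2 = s ^ 2 + 2 * (s * inner ℝ u e) + ‖e‖ ^ 2 := by
      rw [hqx, norm_add_sq_real, real_inner_smul_left, norm_smul, hu, mul_one,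
        Real.norm_eq_abs, sq_abs]
    have h3 : (s + r) ^ 2 ≤ ‖q - x‖ ^ 2 := by gcongr
    have h4 : ‖e‖ ^ 2 ≤ r ^ 2 := by gcongr
    have h5 : r ≤ inner ℝ u e := by
      refine le_of_mul_le_mul_left ?_ hs
      nlinarith
    have h6 : ‖e - r • u‖ ^ 2 ≤ 0 := by
      rw [norm_sub_sq_real, real_inner_smul_right, real_inner_comm, norm_smul, hu, mul_one,
        Real.norm_eq_abs, sq_abs]
      nlinarith
    have h7 : e - r • u = 0 := by
      rw [← norm_eq_zero]
      exact pow_eq_zero_iff two_ne_zero |>.1 (le_antisymm h6 (sq_nonneg _))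
    rw [add_smul, ← add_assoc, ← sub_eq_zero, ← h7, he]
    abel
  rw [← h2]
  refine le_antisymm ?_ hqd
  calc infDist q X ≤ dist q x := infDist_le_dist_of_mem hx
    _ = s + r := by
      rw [h2, dist_eq_norm, add_sub_cancel_left, norm_smul, hu, mul_one,
        Real.norm_of_nonneg (by positivity)]

/-- A normal direction makes an asymptotically non-acute angle with the points of the set. -/
theorem exists_inner_le_of_normal [ProperSpace E] {X : Set E} {a v : E}
    (hnormal : ∀ w ∈ peanoCone X a, inner ℝ v w ≤ 0) {η : ℝ} (hη : 0 < η) :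
    ∃ δ > 0, ∀ x ∈ X, dist x a < δ → inner ℝ v (x - a) ≤ η * ‖x - a‖ := by
  by_contra! H
  choose x hxX hxa hx using fun k : ℕ => H (1 / ((k : ℝ) + 1)) Nat.one_div_pos_of_nat
  have hpos : ∀ k, 0 < ‖x k - a‖ := fun k => by
    refine norm_pos_iff.2 fun h0 => ?_
    have := hx k
    simp [h0] at this
  have hxlim : Tendsto x atTop (𝓝 a) :=
    tendsto_iff_dist_tendsto_zero.2 (squeeze_zero (fun _ => dist_nonneg) (fun k => (hxa k).le)
      tendsto_one_div_add_atTop_nhds_zero_nat)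
  obtain ⟨w, -, φ, hφ, hw⟩ := (isCompact_closedBall (0 : E) 1).tendsto_subseq
    (x := fun k => ‖x k - a‖⁻¹ • (x k - a)) fun k => by
      rw [mem_closedBall_zero_iff, norm_smul, norm_inv, norm_norm, inv_mul_cancel₀ (hpos k).ne']
  have hle := hnormal w ⟨x ∘ φ, fun k => ‖x (φ k) - a‖⁻¹, fun k => hxX _,
    hxlim.comp hφ.tendsto_atTop, fun k => inv_pos.2 (hpos _), hw⟩
  have hge : η ≤ inner ℝ v w := by
    refine ge_of_tendsto' (tendsto_const_nhds.inner hw) fun k => ?_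
    simp only [Function.comp_apply]
    rw [real_inner_smul_right, inv_mul_eq_div, le_div_iff₀ (hpos _)]
    exact (hx _).le
  linarith

/-- Nearest points to `a + t • v`, with `v` normal at `a`, are `o(t)`-close to `a`. -/
theorem exists_norm_nearest_sub_le [ProperSpace E] {X : Set E} {a v : E} (ha : a ∈ X)
    (hv : ‖v‖ = 1) (hnormal : ∀ w ∈ peanoCone X a, inner ℝ v w ≤ 0) {η : ℝ} (hη : 0 < η) :
    ∃ δ > 0, ∀ t, 0 < t → t < δ → ∀ x ∈ nearestPts X (a + t • v), ‖x - a‖ ≤ η * t := by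
  obtain ⟨δ, hδ, H⟩ := exists_inner_le_of_normal hnormal (half_pos hη)
  refine ⟨δ / 2, half_pos hδ, fun t ht0 ht x ⟨hxX, hx⟩ => ?_⟩
  have htv : ‖t • v‖ = t := by rw [norm_smul, hv, mul_one, Real.norm_of_nonneg ht0.le]
  have hle : ‖t • v - (x - a)‖ ≤ t := by
    have := infDist_le_dist_of_mem (x := a + t • v) ha
    rw [← hx, dist_eq_norm, dist_eq_norm, add_sub_cancel_left, htv] at this
    rwa [show t • v - (x - a) = a + t • v - x by abel]
  have h2t : ‖x - a‖ ≤ 2 * t := by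
    have := norm_sub_norm_le (x - a) (t • v)
    rw [norm_sub_rev (x - a), htv] at this
    linarith
  have hin := H x hxX (by rw [dist_eq_norm]; linarith)
  have hsq : ‖t • v - (x - a)‖ ^ 2 ≤ t ^ 2 := by gcongr
  rw [norm_sub_sq_real, htv, real_inner_smul_left] at hsq
  rcases (norm_nonneg (x - a)).eq_or_lt with h0 | h0
  · rw [← h0]; positivity
  · refine le_of_mul_le_mul_left ?_ h0
    nlinarith

/-- Membership in the tangent cone of the closure, from points close to the ray. -/
theorem mem_closure_and_mem_peanoCone {S : Set E} {a v : E}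
    (H : ∀ ε > 0, ∃ s, 0 < s ∧ s < ε ∧ ∃ y ∈ S, dist y (a + s • v) < ε * s) :
    a ∈ closure S ∧ v ∈ peanoCone (closure S) a := by
  choose s hs0 hs y hyS hy using fun k : ℕ => H (1 / ((k : ℝ) + 1)) Nat.one_div_pos_of_nat
  have hε : Tendsto (fun k : ℕ => 1 / ((k : ℝ) + 1)) atTop (𝓝 0) :=
    tendsto_one_div_add_atTop_nhds_zero_nat
  have hslim : Tendsto s atTop (𝓝 0) :=
    squeeze_zero (fun k => (hs0 k).le) (fun k => (hs k).le) hε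
  have hl : Tendsto (fun k => (s k)⁻¹ • (y k - a)) atTop (𝓝 v) := by
    refine tendsto_iff_norm_sub_tendsto_zero.2 (squeeze_zero (fun _ => norm_nonneg _)
      (fun k => ?_) hε)
    have h1 : (s k)⁻¹ • (y k - a) - v = (s k)⁻¹ • (y k - (a + s k • v)) := by
      rw [← sub_sub, smul_sub _ (y k - a), inv_smul_smul₀ (hs0 k).ne']
    rw [h1, norm_smul, norm_inv, Real.norm_of_nonneg (hs0 k).le, ← dist_eq_norm,
      inv_mul_le_iff₀ (hs0 k), mul_comm]
    exact (hy k).le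
  have hylim : Tendsto y atTop (𝓝 a) := by
    have h1 : Tendsto (fun k => s k • ((s k)⁻¹ • (y k - a)) + a) atTop (𝓝 ((0 : ℝ) • v + a)) :=
      (hslim.smul hl).add_const a
    rw [zero_smul, zero_add] at h1
    refine h1.congr fun k => ?_
    rw [smul_inv_smul₀ (hs0 k).ne', sub_add_cancel]
  exact ⟨mem_closure_of_tendsto hylim (Eventually.of_forall hyS),
    y, fun k => (s k)⁻¹, fun k => subset_closure (hyS k), hylim, fun k => inv_pos.2 (hs0 k), hl⟩

/-- If the medial axis misses a conical neighbourhood of the segment from `a` in the normal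
direction `v`, then `a` is approximately at distance `s` from `a + s • v`. -/
theorem sub_le_infDist_of_cone_disjoint [ProperSpace E] {X : Set E} (hX : IsClosed X) {a v : E}
    (ha : a ∈ X) (hv : ‖v‖ = 1) (hnormal : ∀ w ∈ peanoCone X a, inner ℝ v w ≤ 0) {ε : ℝ}
    (hε : 0 < ε) (H : ∀ s, 0 < s → s < ε → ∀ y ∈ medialAxis X, ε * s ≤ dist y (a + s • v))
    {b : ℝ} (hb0 : 0 < b) (hbε : b < ε) {η : ℝ} (hη0 : 0 < η) (hη : η ≤ 1 / 2)
    (hηε : 12 * η ≤ ε) : b - 6 * η * b ≤ infDist (a + b • v) X := by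
  obtain ⟨δ, hδ, hnear⟩ := exists_norm_nearest_sub_le ha hv hnormal hη0
  obtain ⟨t, ht0, ht⟩ := exists_between (lt_min hδ hb0)
  obtain ⟨x, hxX, hx⟩ := hX.exists_infDist_eq_dist ⟨a, ha⟩ (a + t • v)
  have hxa := hnear t ht0 (ht.trans_le (min_le_left _ _)) x ⟨hxX, hx.symm⟩
  have htb : t < b := ht.trans_le (min_le_right _ _)
  have htv : ‖t • v‖ = t := by rw [norm_smul, hv, mul_one, Real.norm_of_nonneg ht0.le]
  set L := infDist (a + t • v) X with hL
  have hLn : ‖a + t • v - x‖ = L := by rw [hx, dist_eq_norm]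
  have hLt : L ≤ t := by
    have := infDist_le_dist_of_mem (x := a + t • v) ha
    rwa [dist_eq_norm, add_sub_cancel_left, htv] at this
  have htL : t ≤ L + ‖x - a‖ := by
    have := norm_add_le (a + t • v - x) (x - a)
    rwa [show a + t • v - x + (x - a) = t • v by abel, htv, hLn] at this
  have htL2 : t ≤ 2 * L := by nlinarith
  have hL0 : 0 < L := by linarith
  set u : E := L⁻¹ • (a + t • v - x) with hu
  have hnu : ‖u‖ = 1 := by
    rw [hu, norm_smul, hLn, norm_inv, Real.norm_of_nonneg hL0.le, inv_mul_cancel₀ hL0.ne']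
  have hLu : L • u = a + t • v - x := by rw [hu, smul_inv_smul₀ hL0.ne']
  have huv : ‖u - v‖ ≤ 4 * η := by
    have h1 : L • (u - v) = (t - L) • v - (x - a) := by
      rw [smul_sub, hLu, sub_smul]; abel
    have h2 : L * ‖u - v‖ ≤ (t - L) + ‖x - a‖ := by
      have h3 := norm_sub_le ((t - L) • v) (x - a)
      rwa [← h1, norm_smul, norm_smul, hv, mul_one, Real.norm_of_nonneg hL0.le,
        Real.norm_of_nonneg (sub_nonneg.2 hLt)] at h3
    refine le_of_mul_le_mul_left ?_ hL0
    nlinarith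
  have hclose : ∀ s, L ≤ s → dist (x + s • u) (a + s • v) ≤ 6 * η * s := by
    intro s hs
    have hs0 : 0 < s := hL0.trans_le hs
    rw [dist_eq_norm, show x + s • u - (a + s • v) = (x - a) + s • (u - v) by
      rw [smul_sub]; abel]
    refine (norm_add_le _ _).trans ?_
    rw [norm_smul, Real.norm_of_nonneg hs0.le]
    nlinarith
  have hIcc : Set.Icc L b ⊆ {s | infDist (x + s • u) X = s} := by
    refine IsClosed.Icc_subset_of_forall_exists_gt ?_ ?_ ?_
    · refine (isClosed_eq ((continuous_infDist_pt X).comp (by fun_prop)) continuous_id).inter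
        isClosed_Icc
    · change infDist (x + L • u) X = L
      rw [hLu, add_sub_cancel]
    · rintro s ⟨hsd, hLs, hsb⟩ y (hy : s < y)
      have hs0 : 0 < s := hL0.trans_le hLs
      have hr : 0 < min (y - s) (ε * s / 2) := lt_min (sub_pos.2 hy) (by positivity)
      refine ⟨s + min (y - s) (ε * s / 2), infDist_add_smul_of_disjoint hX hxX hnu hs0 hr hsd ?_,
        by linarith, by linarith [min_le_left (y - s) (ε * s / 2)]⟩
      refine Set.disjoint_left.2 fun z hz hzM => ?_
      have h1 := H s hs0 (hsb.trans hbε) z hzM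
      have h2 := dist_triangle z (x + s • u) (a + s • v)
      have h3 := (mem_ball.1 hz).trans_le (min_le_right _ _)
      nlinarith [hclose s hLs]
  have hbL : L ≤ b := hLt.trans htb.le
  have hdb : infDist (x + b • u) X = b := hIcc ⟨hbL, le_rfl⟩
  have h1 := infDist_le_infDist_add_dist (s := X) (x := x + b • u) (y := a + b • v)
  linarith [hclose b hbL]

end Auxiliary

/-- if `X ⊆ ℝⁿ` is a nonempty proper closed set, `a ∈ X`, and `v` is a unit
normal direction at `a` whose directional reaching radius vanishes (i.e. `a ∉ m(a + tv)`
for every `t > 0`), then `a ∈ closure M_X` and `v` is tangent to `closure M_X` at `a`. -/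
theorem stmt2 (n : ℕ) (X : Set (EuclideanSpace ℝ (Fin n))) (hne : X.Nonempty)
    (hprop : X ≠ Set.univ) (hX : IsClosed X)
    (a : EuclideanSpace ℝ (Fin n)) (ha : a ∈ X)
    (v : EuclideanSpace ℝ (Fin n)) (hv : ‖v‖ = 1)
    (hnormal : ∀ w ∈ peanoCone X a, ⟪v, w⟫ ≤ 0)
    (hr : ∀ t : ℝ, 0 < t → a ∉ nearestPts X (a + t • v)) :
    a ∈ closure (medialAxis X) ∧ v ∈ peanoCone (closure (medialAxis X)) a := by
  refine mem_closure_and_mem_peanoCone ?_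
  by_contra! H
  obtain ⟨ε, hε, H⟩ := H
  have hb : 0 < ε / 2 := half_pos hε
  refine hr (ε / 2) hb ⟨ha, le_antisymm ?_ (infDist_le_dist_of_mem ha)⟩
  rw [dist_eq_norm, add_sub_cancel_left, norm_smul, hv, mul_one, Real.norm_of_nonneg hb.le]
  have hl : Tendsto (fun η : ℝ => ε / 2 - 6 * η * (ε / 2)) (𝓝[>] 0)
      (𝓝 (ε / 2 - 6 * 0 * (ε / 2))) :=
    (Continuous.tendsto (by fun_prop) (0 : ℝ)).mono_left nhdsWithin_le_nhds
  rw [mul_zero, zero_mul, sub_zero] at hl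
  refine le_of_tendsto hl ?_
  filter_upwards [Ioo_mem_nhdsGT (lt_min (half_pos one_pos) (div_pos hε (by norm_num : (0 : ℝ) < 12)))]
    with η hη
  have h1 := hη.2.trans_le (min_le_left _ _)
  have h2 := hη.2.trans_le (min_le_right _ _)
  exact sub_le_infDist_of_cone_disjoint hX ha hv hnormal hε H hb (half_lt_self hε) hη.1 h1.le
    (by linarith)
end
end

section
/- Let X ⊆ ℝⁿ be a set with 0 ∈ X and let v ∈ ℝⁿ be a unit vector. Suppose there exists a sequence x_ν ∈ X with x_ν → 0, ⟨x_ν, v⟩ > 0 for all ν, and ‖x_ν‖²/⟨x_ν, v⟩ → 0. Then for every t > 0 there exists x ∈ X with ‖tv − x‖ < t; in particular 0 ∉ m(tv) for every t > 0, i.e. the directional reaching radius satisfies r_v(0) = 0. -/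
open Filter Topology Metric

noncomputable section

local notation "⟪" x ", " y "⟫" => @inner ℝ _ _ x y

/-- A point `p` with `‖p‖² / ⟪p, v⟫ < 2t` is closer to `t • v` than the origin is. -/
theorem norm_smul_sub_lt_of_sq_div_inner_lt {E : Type*} [NormedAddCommGroup E]
    [InnerProductSpace ℝ E] {p v : E} {t : ℝ} (hv : ‖v‖ = 1) (ht : 0 < t)
    (hp : 0 < ⟪p, v⟫) (hlt : ‖p‖ ^ 2 / ⟪p, v⟫ < 2 * t) : ‖t • v - p‖ < t := by
  rw [div_lt_iff₀ hp] at hlt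
  refine lt_of_pow_lt_pow_left₀ 2 ht.le ?_
  rw [norm_sub_sq_real, norm_smul, hv, mul_one, Real.norm_of_nonneg ht.le,
    real_inner_smul_left, real_inner_comm]
  linarith

/-- A nearest point of `X` to `a` is at most as far from `a` as any other point of `X`. -/
theorem dist_le_of_mem_nearestPts {E : Type*} [NormedAddCommGroup E] {X : Set E} {a x p : E}
    (hx : x ∈ nearestPts X a) (hp : p ∈ X) : dist a x ≤ dist a p :=
  hx.2.trans_le (Metric.infDist_le_dist_of_mem hp)

/-- Every point of `X` is a nearest point of `X` to itself. -/
theorem self_mem_nearestPts {E : Type*} [NormedAddCommGroup E] {X : Set E} {a : E}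
    (ha : a ∈ X) : a ∈ nearestPts X a :=
  ⟨ha, by rw [dist_self, Metric.infDist_zero_of_mem ha]⟩

/-- if `0 ∈ X ⊆ ℝⁿ`, `v` is a unit vector, and there is a sequence
`x_ν ∈ X`, `x_ν → 0`, with `⟪x_ν, v⟫ > 0` and `‖x_ν‖²/⟪x_ν, v⟫ → 0`, then every
ball `B(tv, t)`, `t > 0`, meets `X`; in particular `0 ∉ m(tv)` for every `t > 0`,
i.e. the directional reaching radius `r_v(0) = sup{t ≥ 0 : 0 ∈ m(tv)}` vanishes. -/
theorem stmt3 (n : ℕ) (X : Set (EuclideanSpace ℝ (Fin n))) (h0 : (0 : EuclideanSpace ℝ (Fin n)) ∈ X)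
    (v : EuclideanSpace ℝ (Fin n)) (hv : ‖v‖ = 1)
    (x : ℕ → EuclideanSpace ℝ (Fin n)) (hxX : ∀ ν, x ν ∈ X)
    (hx0 : Tendsto x atTop (𝓝 0)) (hpos : ∀ ν, 0 < ⟪x ν, v⟫)
    (hquot : Tendsto (fun ν => ‖x ν‖ ^ 2 / ⟪x ν, v⟫) atTop (𝓝 0)) :
    (∀ t : ℝ, 0 < t → ∃ p ∈ X, ‖t • v - p‖ < t) ∧
    (∀ t : ℝ, 0 < t → (0 : EuclideanSpace ℝ (Fin n)) ∉ nearestPts X (t • v)) ∧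
    sSup {t : ℝ | 0 ≤ t ∧ (0 : EuclideanSpace ℝ (Fin n)) ∈ nearestPts X (t • v)} = 0 := by
  have hball : ∀ t : ℝ, 0 < t → ∃ p ∈ X, ‖t • v - p‖ < t := fun t ht => by
    obtain ⟨ν, hν⟩ := (hquot.eventually_lt_const (mul_pos two_pos ht)).exists
    exact ⟨x ν, hxX ν, norm_smul_sub_lt_of_sq_div_inner_lt hv ht (hpos ν) hν⟩
  have hnot : ∀ t : ℝ, 0 < t →
      (0 : EuclideanSpace ℝ (Fin n)) ∉ nearestPts X (t • v) := fun t ht hmem => by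
    obtain ⟨p, hpX, hp⟩ := hball t ht
    have hle := dist_le_of_mem_nearestPts hmem hpX
    rw [dist_zero_right, norm_smul, hv, mul_one, Real.norm_of_nonneg ht.le, dist_eq_norm] at hle
    exact hle.not_gt hp
  refine ⟨hball, hnot, ?_⟩
  have hset : {t : ℝ | 0 ≤ t ∧ (0 : EuclideanSpace ℝ (Fin n)) ∈ nearestPts X (t • v)} = {0} := by
    ext t
    constructor
    · rintro ⟨ht, hmem⟩
      exact (ht.eq_or_lt.resolve_right fun hlt => hnot t hlt hmem).symm
    · rintro rfl
      exact ⟨le_rfl, by simpa using self_mem_nearestPts h0⟩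
  rw [hset, csSup_singleton]
end
end

section
/- Let 1 ≤ k < n and let X ⊆ ℝⁿ = ℝ^k × ℝ^{n−k} be a nonempty proper closed set with 0 ∈ X whose Peano tangent cone satisfies C₀X ⊆ ℝ^k × {0}^{n−k}. Suppose there exists a sequence p_ν = (x_ν, y_ν) ∈ X with p_ν → 0, y_ν ≠ 0 for all ν, and ‖y_ν‖/‖p_ν‖² → +∞. Then 0 ∈ closure(M_X). -/
open Filter Topology Metric

noncomputable section

section MedialAxis

variable {E : Type*} [NormedAddCommGroup E] {X : Set E}

/-- Away from the medial axis the nearest point map is continuous. -/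
lemma tendsto_nearestPts [ProperSpace E] (hX : IsClosed X) {x b : E} (hx : x ∉ medialAxis X)
    (hb : b ∈ nearestPts X x) {z q : ℕ → E} (hz : Tendsto z atTop (𝓝 x))
    (hq : ∀ j, q j ∈ nearestPts X (z j)) : Tendsto q atTop (𝓝 b) := by
  refine tendsto_of_subseq_tendsto fun ns hns => ?_
  have hz' := hz.comp hns
  have hinf : Tendsto (fun j => infDist (z (ns j)) X) atTop (𝓝 (infDist x X)) :=
    ((continuous_infDist_pt X).tendsto x).comp hz'
  have hbdd : Bornology.IsBounded (Set.range (q ∘ ns)) := by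
    obtain ⟨A, hA⟩ := hinf.bddAbove_range
    obtain ⟨B, hB⟩ := (hz'.dist (tendsto_const_nhds (x := x))).bddAbove_range
    refine (isBounded_iff_subset_closedBall x).2 ⟨A + B, ?_⟩
    rintro _ ⟨j, rfl⟩
    have h1 := hA ⟨j, rfl⟩
    have h2 := hB ⟨j, rfl⟩
    have h3 := (hq (ns j)).2
    have h4 := dist_triangle_left (q (ns j)) x (z (ns j))
    simp only [Function.comp_apply, mem_closedBall] at *
    linarith
  obtain ⟨y, -, φ, hφ, hy⟩ := tendsto_subseq_of_bounded hbdd (fun j => Set.mem_range_self j)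
  refine ⟨φ, ?_⟩
  have hyX : y ∈ X := hX.mem_of_tendsto hy (Eventually.of_forall fun j => (hq _).1)
  have hdist : dist x y = infDist x X := by
    refine tendsto_nhds_unique ((hz'.comp hφ.tendsto_atTop).dist hy) ?_
    refine (hinf.comp hφ.tendsto_atTop).congr fun j => ?_
    exact (hq (ns (φ j))).2.symm
  have : y = b := by
    by_contra hne
    exact hx ⟨y, ⟨hyX, hdist⟩, b, hb, hne⟩
  exact this ▸ hy

lemma nearestPts_nonempty [ProperSpace E] (hX : IsClosed X) (hne : X.Nonempty) (a : E) :
    (nearestPts X a).Nonempty := by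
  obtain ⟨y, hy, h⟩ := hX.exists_infDist_eq_dist hne a
  exact ⟨y, hy, h.symm⟩

variable [InnerProductSpace ℝ E] [ProperSpace E]

/-- Off the medial axis, the distance to `X` has ascent rate at least any `θ < 1`. -/
lemma exists_infDist_ascent (hX : IsClosed X) (hne : X.Nonempty) {x : E}
    (hx : x ∉ medialAxis X) (hxX : x ∉ X) {θ : ℝ} (hθ : θ < 1) {η : ℝ} (hη : 0 < η) :
    ∃ z, z ≠ x ∧ dist z x < η ∧ infDist x X + θ * dist z x ≤ infDist z X := by
  obtain ⟨b, hb⟩ := nearestPts_nonempty hX hne x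
  have hxb : 0 < ‖x - b‖ := by
    rw [norm_pos_iff, sub_ne_zero]
    rintro rfl
    exact hxX hb.1
  set u : E := ‖x - b‖⁻¹ • (x - b) with hu
  have hu1 : ‖u‖ = 1 := by
    rw [hu, norm_smul, norm_inv, norm_norm, inv_mul_cancel₀ hxb.ne']
  set s : ℕ → ℝ := fun j => 1 / ((j : ℝ) + 1) with hs
  have hspos : ∀ j, 0 < s j := fun j => by positivity
  have hs0 : Tendsto s atTop (𝓝 0) := tendsto_one_div_add_atTop_nhds_zero_nat
  have hz : Tendsto (fun j => x + s j • u) atTop (𝓝 x) := by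
    simpa using (hs0.smul_const u).const_add x
  choose q hq using fun j => nearestPts_nonempty hX hne (x + s j • u)
  have hqb := tendsto_nearestPts hX hx hb hz hq
  have hlim : Tendsto (fun j => inner ℝ u (‖x - q j‖⁻¹ • (x - q j))) atTop (𝓝 1) := by
    have h1 : Tendsto (fun j => x - q j) atTop (𝓝 (x - b)) := hqb.const_sub x
    have h2 := (tendsto_const_nhds (x := u)).inner (𝕜 := ℝ) ((h1.norm.inv₀ hxb.ne').smul h1)
    rwa [← hu, real_inner_self_eq_norm_sq, hu1, one_pow] at h2
  obtain ⟨j, hj1, hj2⟩ := ((hlim.eventually_const_lt hθ).and (hs0.eventually_lt_const hη)).exists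
  have hd : dist (x + s j • u) x = s j := by
    rw [dist_eq_norm, add_sub_cancel_left, norm_smul, hu1, mul_one, Real.norm_eq_abs,
      abs_of_pos (hspos j)]
  have hzx : x + s j • u ≠ x := dist_pos.1 (hd.symm ▸ hspos j)
  refine ⟨x + s j • u, hzx, hd.symm ▸ hj2, ?_⟩
  rw [hd, ← (hq j).2]
  have hxq : infDist x X ≤ ‖x - q j‖ := by
    rw [← dist_eq_norm]
    exact infDist_le_dist_of_mem (hq j).1
  have hpos : 0 < ‖x - q j‖ := by
    rw [norm_pos_iff, sub_ne_zero]
    rintro h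
    exact hxX (h ▸ (hq j).1)
  set m : E := ‖x - q j‖⁻¹ • (x - q j) with hm
  have hm1 : ‖m‖ = 1 := by
    rw [hm, norm_smul, norm_inv, norm_norm, inv_mul_cancel₀ hpos.ne']
  have h1 : inner ℝ (x + s j • u - q j) m ≤ ‖x + s j • u - q j‖ := by
    simpa [hm1] using real_inner_le_norm (x + s j • u - q j) m
  have h2 : inner ℝ (x + s j • u - q j) m = ‖x - q j‖ + s j * inner ℝ u m := by
    rw [show x + s j • u - q j = (x - q j) + s j • u by abel, inner_add_left,
      real_inner_smul_left]
    congr 1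
    rw [hm, real_inner_smul_right, real_inner_self_eq_norm_sq]
    field_simp
  rw [dist_eq_norm]
  nlinarith [mul_le_mul_of_nonneg_left hj1.le (hspos j).le]

/-- Inside a ball that misses the medial axis, distances to `X` grow at unit speed along normal
rays: a nearest point stays nearest along its ray. -/
lemma mem_nearestPts_ray (hX : IsClosed X) (hne : X.Nonempty) {c b : E} {ρ : ℝ} (hρ : 0 < ρ)
    (hM : ∀ x ∈ closedBall c ρ, x ∉ medialAxis X) (hc : c ∉ X) (hb : b ∈ nearestPts X c) :
    b ∈ nearestPts X (c + (ρ / ‖c - b‖) • (c - b)) := by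
  have hcpos : 0 < infDist c X := (hX.notMem_iff_infDist_pos hne).1 hc
  have hcont := continuous_infDist_pt X
  have key : ∀ θ : ℝ, 0 < θ → θ < 1 →
      ∃ x ∈ closedBall c ρ, infDist c X + θ * ρ ≤ infDist x X := by
    intro θ hθ0 hθ
    obtain ⟨x, hxm, hmax⟩ := (isCompact_closedBall c ρ).exists_isMaxOn
      ⟨c, mem_closedBall_self hρ.le⟩
      (f := fun x => infDist x X - θ * dist x c) (by fun_prop)
    have hmc : infDist c X ≤ infDist x X - θ * dist x c := by
      simpa using hmax (mem_closedBall_self hρ.le)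
    refine ⟨x, hxm, ?_⟩
    rcases (mem_closedBall.1 hxm).lt_or_eq with hlt | heq
    · exfalso
      have hxX : x ∉ X := by
        rw [hX.notMem_iff_infDist_pos hne]
        have := mul_nonneg hθ0.le (dist_nonneg (x := x) (y := c))
        linarith
      obtain ⟨z, hzx, hzd, hz⟩ := exists_infDist_ascent hX hne (hM x hxm) hxX
        (θ := (1 + θ) / 2) (by linarith) (sub_pos.2 hlt)
      have htri := dist_triangle z x c
      have hzm : z ∈ closedBall c ρ := mem_closedBall.2 (by linarith)
      have h : infDist z X - θ * dist z c ≤ infDist x X - θ * dist x c := hmax hzm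
      have hpos := dist_pos.2 hzx
      nlinarith
    · rw [heq] at hmc
      linarith
  obtain ⟨x, hxm, hmax⟩ := (isCompact_closedBall c ρ).exists_isMaxOn
    ⟨c, mem_closedBall_self hρ.le⟩ (f := fun x => infDist x X) (by fun_prop)
  have hge : infDist c X + ρ ≤ infDist x X := by
    refine le_of_forall_pos_lt_add fun ε hε => ?_
    obtain ⟨y, hy, hy'⟩ := key (max (1 / 2) (1 - ε / (2 * ρ))) (by positivity)
      (max_lt (by norm_num) (by linarith [show 0 < ε / (2 * ρ) by positivity]))
    have h1 : infDist y X ≤ infDist x X := hmax hy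
    have h2 := mul_le_mul_of_nonneg_right (le_max_right (1 / 2) (1 - ε / (2 * ρ))) hρ.le
    have h3 : (1 - ε / (2 * ρ)) * ρ = ρ - ε / 2 := by field_simp
    linarith
  have hxc := mem_closedBall.1 hxm
  have hxb : infDist x X ≤ dist x b := infDist_le_dist_of_mem hb.1
  have htri := dist_triangle x c b
  have hcb := hb.2
  have hdx : dist x c = ρ := by linarith
  have hray : SameRay ℝ (x - c) (c - b) := by
    rw [sameRay_iff_norm_add, sub_add_sub_cancel, ← dist_eq_norm, ← dist_eq_norm,
      ← dist_eq_norm]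
    linarith
  have hcb' : ‖c - b‖ ≠ 0 := by
    rw [← dist_eq_norm, hcb]
    exact hcpos.ne'
  have hx : x = c + (ρ / ‖c - b‖) • (c - b) := by
    rw [← sub_eq_iff_eq_add', div_eq_inv_mul, mul_smul, ← hdx, dist_eq_norm,
      hray.norm_smul_eq, smul_smul, inv_mul_cancel₀ hcb', one_smul]
  rw [← hx]
  exact ⟨hb.1, by linarith⟩

/-- If the nearest point map is single-valued near `0 ∈ X`, then every direction polar to the
tangent cone at `0` is a normal whose rolling ball radius is bounded below uniformly. -/
lemma two_mul_inner_le_sq_of_polar (hX : IsClosed X) (h0 : (0 : E) ∈ X) {ρ : ℝ} (hρ : 0 < ρ)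
    (hM : ∀ x ∈ ball (0 : E) (2 * ρ), x ∉ medialAxis X) {v : E} (hv : ‖v‖ = 1)
    (hpolar : ∀ w ∈ peanoCone X 0, inner ℝ w v ≤ 0) {x : E} (hx : x ∈ X) :
    2 * ρ * inner ℝ x v ≤ ‖x‖ ^ 2 := by
  have hne : X.Nonempty := ⟨0, h0⟩
  set s : ℕ → ℝ := fun j => 1 / ((j : ℝ) + 1) with hs
  have hspos : ∀ j, 0 < s j := fun j => by positivity
  have hs0 : Tendsto s atTop (𝓝 0) := tendsto_one_div_add_atTop_nhds_zero_nat
  choose b hb using fun j => nearestPts_nonempty hX hne (s j • v)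
  set q : ℕ → E := fun j => (s j)⁻¹ • b j with hq
  have hbq : ∀ j, b j = s j • q j := fun j => by
    rw [hq, smul_smul, mul_inv_cancel₀ (hspos j).ne', one_smul]
  have hqle : ∀ j, ‖v - q j‖ ≤ 1 := by
    intro j
    have h1 : dist (s j • v) (b j) ≤ dist (s j • v) 0 :=
      (hb j).2 ▸ infDist_le_dist_of_mem h0
    rw [hbq j, dist_eq_norm, ← smul_sub, norm_smul, dist_zero_right, norm_smul, hv,
      Real.norm_eq_abs, abs_of_pos (hspos j)] at h1
    exact le_of_mul_le_mul_left h1 (hspos j)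
  have hqin : ∀ j, ‖q j‖ ^ 2 ≤ 2 * inner ℝ (q j) v := by
    intro j
    have h1 := norm_sub_sq_real v (q j)
    have h2 : ‖v - q j‖ ^ 2 ≤ 1 := pow_le_one₀ (norm_nonneg _) (hqle j)
    rw [real_inner_comm, hv] at h1
    linarith
  have hqmem : ∀ j, q j ∈ closedBall v 1 := fun j => by
    rw [mem_closedBall, dist_comm, dist_eq_norm]
    exact hqle j
  have hqbdd : ∀ j, ‖q j‖ ≤ 2 := fun j => by
    have := norm_sub_norm_le (q j) v
    have h2 := hqle j
    rw [norm_sub_rev] at h2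
    linarith
  have hb0 : Tendsto b atTop (𝓝 0) := by
    refine squeeze_zero_norm (a := fun j => s j * 2) (fun j => ?_) (by simpa using hs0.mul_const 2)
    rw [hbq j, norm_smul, Real.norm_eq_abs, abs_of_pos (hspos j)]
    exact mul_le_mul_of_nonneg_left (hqbdd j) (hspos j).le
  have hq0 : Tendsto q atTop (𝓝 0) := by
    refine tendsto_of_subseq_tendsto fun ns hns => ?_
    obtain ⟨w, -, φ, hφ, hw⟩ := (isCompact_closedBall v 1).tendsto_subseq
      (fun j => hqmem (ns j))
    refine ⟨φ, ?_⟩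
    have hwc : w ∈ peanoCone X 0 := by
      refine ⟨fun j => b (ns (φ j)), fun j => (s (ns (φ j)))⁻¹, fun j => (hb _).1,
        hb0.comp (hns.comp hφ.tendsto_atTop), fun j => inv_pos.2 (hspos _), ?_⟩
      simp only [sub_zero]
      exact hw
    have h1 : ‖w‖ ^ 2 ≤ 2 * inner ℝ w v :=
      le_of_tendsto_of_tendsto' (hw.norm.pow 2)
        ((hw.inner (tendsto_const_nhds (x := v))).const_mul 2) fun j => hqin _
    have h2 := hpolar w hwc
    have h3 : w = 0 := by
      rw [← norm_eq_zero, ← sq_eq_zero_iff]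
      exact le_antisymm (by linarith) (sq_nonneg _)
    exact h3 ▸ hw
  have hvq : Tendsto (fun j => v - q j) atTop (𝓝 v) := by simpa using hq0.const_sub v
  have hlim : Tendsto (fun j => s j • v + (ρ / ‖v - q j‖) • (v - q j)) atTop (𝓝 (ρ • v)) := by
    have h1 : Tendsto (fun j => ρ / ‖v - q j‖) atTop (𝓝 ρ) := by
      have h2 := (tendsto_const_nhds (x := ρ)).div hvq.norm (by simp [hv])
      rwa [hv, div_one] at h2
    simpa using (hs0.smul_const v).add (h1.smul hvq)
  have hpos : ∀ᶠ j in atTop, 0 < ‖v - q j‖ := by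
    refine hvq.norm.eventually_const_lt ?_
    rw [hv]
    exact one_pos
  have hev : ∀ᶠ j in atTop, dist (s j • v + (ρ / ‖v - q j‖) • (v - q j)) (b j) ≤
      dist (s j • v + (ρ / ‖v - q j‖) • (v - q j)) x := by
    filter_upwards [hpos, hs0.eventually_lt_const hρ] with j hj1 hj2
    have hcb : s j • v - b j = s j • (v - q j) := by rw [hbq j, smul_sub]
    have hn : ‖s j • v - b j‖ = s j * ‖v - q j‖ := by
      rw [hcb, norm_smul, Real.norm_eq_abs, abs_of_pos (hspos j)]
    have hc : s j • v ∉ X := by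
      rw [hX.notMem_iff_infDist_pos hne, ← (hb j).2, dist_eq_norm, hn]
      exact mul_pos (hspos j) hj1
    have hM' : ∀ y ∈ closedBall (s j • v) ρ, y ∉ medialAxis X := by
      intro y hy
      refine hM y ?_
      have h1 := dist_triangle y (s j • v) 0
      rw [dist_zero_right (s j • v), norm_smul, hv, Real.norm_eq_abs, abs_of_pos (hspos j)] at h1
      rw [mem_closedBall] at hy
      rw [mem_ball]
      linarith
    have h := mem_nearestPts_ray hX hne hρ hM' hc (hb j)
    have heq : (ρ / ‖s j • v - b j‖) • (s j • v - b j) = (ρ / ‖v - q j‖) • (v - q j) := by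
      rw [hn, hcb, smul_smul]
      congr 1
      have := (hspos j).ne'
      field_simp
    rw [heq] at h
    rw [h.2]
    exact infDist_le_dist_of_mem hx
  have hle : dist (ρ • v) 0 ≤ dist (ρ • v) x :=
    le_of_tendsto_of_tendsto (hlim.dist hb0) (hlim.dist tendsto_const_nhds) hev
  rw [dist_zero_right, dist_eq_norm] at hle
  have h1 := pow_le_pow_left₀ (norm_nonneg _) hle 2
  rw [norm_sub_sq_real, real_inner_smul_left, real_inner_comm] at h1
  linarith

end MedialAxis

/-- let `X ⊆ ℝ^k × ℝ^{n-k}` be a nonempty proper closed set containing `0`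
with `C₀X ⊆ ℝ^k × {0}`. If there is a sequence `p_ν = (x_ν, y_ν) ∈ X` with `p_ν → 0`,
`y_ν ≠ 0` and `‖y_ν‖/‖p_ν‖² → +∞`, then the medial axis reaches the origin. -/
theorem stmt5 (n k : ℕ) (hk : 1 ≤ k) (hkn : k < n)
    (X : Set (Amb k (n - k))) (hne : X.Nonempty) (hprop : X ≠ Set.univ)
    (hX : IsClosed X) (h0 : (0 : Amb k (n - k)) ∈ X)
    (hcone : peanoCone X 0 ⊆ {w : Amb k (n - k) | ver w = 0})
    (p : ℕ → Amb k (n - k)) (hpX : ∀ ν, p ν ∈ X)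
    (hp0 : Tendsto p atTop (𝓝 0))
    (hy : ∀ ν, ver (p ν) ≠ 0)
    (hsq : Tendsto (fun ν => ‖ver (p ν)‖ / ‖p ν‖ ^ 2) atTop atTop) :
    (0 : Amb k (n - k)) ∈ closure (medialAxis X) := by
  by_contra hcl
  have hop : (closure (medialAxis X))ᶜ ∈ 𝓝 (0 : Amb k (n - k)) :=
    isClosed_closure.isOpen_compl.mem_nhds hcl
  obtain ⟨R, hR, hball⟩ := Metric.mem_nhds_iff.1 hop
  have hρ : 0 < R / 2 := half_pos hR
  have hM : ∀ x ∈ ball (0 : Amb k (n - k)) (2 * (R / 2)), x ∉ medialAxis X := by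
    intro x hx hxM
    rw [mul_div_cancel₀ R two_ne_zero] at hx
    exact hball hx (subset_closure hxM)
  have : ProperSpace (Amb k (n - k)) := FiniteDimensional.proper ℝ _
  obtain ⟨ν, hν⟩ := (hsq.eventually_gt_atTop (1 / R)).exists
  have hypos : 0 < ‖ver (p ν)‖ := norm_pos_iff.2 (hy ν)
  set v : Amb k (n - k) := WithLp.toLp 2 (0, ‖ver (p ν)‖⁻¹ • ver (p ν)) with hvdef
  have hinner : ∀ w : Amb k (n - k),
      inner ℝ w v = ‖ver (p ν)‖⁻¹ * inner ℝ (ver w) (ver (p ν)) := by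
    intro w
    rw [WithLp.prod_inner_apply, hvdef]
    simp only [inner_zero_right, zero_add, real_inner_smul_right]
    rfl
  have hv : ‖v‖ = 1 := by
    have h1 : ‖v‖ ^ 2 = 1 := by
      rw [← real_inner_self_eq_norm_sq, hinner,
        show ver v = ‖ver (p ν)‖⁻¹ • ver (p ν) from rfl, real_inner_smul_left,
        real_inner_self_eq_norm_sq]
      field_simp
    exact (pow_eq_one_iff_of_nonneg (norm_nonneg v) two_ne_zero).1 h1
  have h := two_mul_inner_le_sq_of_polar hX h0 hρ hM hv (fun w hw => by
    rw [hinner, show ver w = 0 from hcone hw, inner_zero_left, mul_zero]) (hpX ν)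
  rw [hinner, real_inner_self_eq_norm_sq, sq ‖ver (p ν)‖, inv_mul_cancel_left₀ hypos.ne',
    mul_div_cancel₀ R two_ne_zero] at h
  have hppos : 0 < ‖p ν‖ ^ 2 := lt_of_lt_of_le (mul_pos hR hypos) h
  rw [div_lt_div_iff₀ hR hppos] at hν
  linarith
end
end

section
/- Let a > 0 and let p = (p₁, p₂) ∈ ℝ² satisfy |p₂| ≤ 1/(2a). Let r ≥ 0, and suppose there exist s > 0, s' > 0 and signs σ, σ' ∈ {−1, 1} such that ‖p − (s, σ a s²)‖ ≤ r and ‖p − (−s', σ' a s'²)‖ ≤ r. Then ‖p‖ ≤ r; that is, every closed disc centred at p that meets both the right half and the left half of the double parabola {(x, y) ∈ ℝ² : |y| = a x²} ∖ {0} contains the origin. -/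
open Filter Topology Metric

noncomputable section

/-- The point `(x, y)` of the Euclidean plane. -/
def pt (x y : ℝ) : EuclideanSpace ℝ (Fin 2) := (WithLp.equiv 2 (Fin 2 → ℝ)).symm ![x, y]

/-- A point of the double parabola on the other side of the vertical axis from `p` is at least as
far from `p` as the origin is, provided `|p₂| ≤ 1 / (2a)`. -/
theorem norm_le_norm_sub_pt {a : ℝ} (ha : 0 < a) {p : EuclideanSpace ℝ (Fin 2)}
    (hp2 : |p 1| ≤ 1 / (2 * a)) {t σ : ℝ} (ht : p 0 * t ≤ 0) (hσ : σ = 1 ∨ σ = -1) :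
    ‖p‖ ≤ ‖p - pt t (σ * (a * t ^ 2))‖ := by
  rw [le_div_iff₀ (by positivity), ← abs_of_pos (by positivity : 0 < 2 * a), ← abs_mul,
    abs_le] at hp2
  obtain ⟨hlo, hhi⟩ := hp2
  rw [EuclideanSpace.norm_eq, EuclideanSpace.norm_eq]
  apply Real.sqrt_le_sqrt
  simp only [Fin.sum_univ_two, Real.norm_eq_abs, sq_abs, pt, PiLp.sub_apply,
    WithLp.equiv_symm_apply, Matrix.cons_val_zero, Matrix.cons_val_one]
  rcases hσ with rfl | rfl
  · nlinarith [mul_nonneg (sub_nonneg.mpr hhi) (sq_nonneg t), sq_nonneg (a * t ^ 2)]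
  · nlinarith [mul_nonneg (neg_le_iff_add_nonneg.mp hlo) (sq_nonneg t), sq_nonneg (a * t ^ 2)]

/-- let `a > 0` and `p = (p₁, p₂) ∈ ℝ²` with `|p₂| ≤ 1/(2a)`. If a closed
disc of radius `r` centred at `p` meets both the right half and the left half of the
double parabola `{|y| = ax²} ∖ {0}`, then it contains the origin: `‖p‖ ≤ r`. -/
theorem stmt9 (a : ℝ) (ha : 0 < a) (p : EuclideanSpace ℝ (Fin 2))
    (hp2 : |p 1| ≤ 1 / (2 * a)) (r : ℝ) (hr : 0 ≤ r)
    (s s' σ σ' : ℝ) (hs : 0 < s) (hs' : 0 < s')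
    (hσ : σ = 1 ∨ σ = -1) (hσ' : σ' = 1 ∨ σ' = -1)
    (h1 : ‖p - pt s (σ * (a * s ^ 2))‖ ≤ r)
    (h2 : ‖p - pt (-s') (σ' * (a * s' ^ 2))‖ ≤ r) :
    ‖p‖ ≤ r := by
  rcases le_total (p 0) 0 with h | h
  · exact (norm_le_norm_sub_pt ha hp2 (mul_nonpos_of_nonpos_of_nonneg h hs.le) hσ).trans h1
  · have h2' : ‖p - pt (-s') (σ' * (a * (-s') ^ 2))‖ ≤ r := by rwa [neg_sq]
    exact (norm_le_norm_sub_pt ha hp2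
      (mul_nonpos_of_nonneg_of_nonpos h (neg_nonpos.mpr hs'.le)) hσ').trans h2'
end
end

section
/- Let X := {(x, y, z) ∈ ℝ³ : x³ = y² + z²} (the horn surface). Then for every t ∈ (0, 1) the point (t, 0, 0) belongs to the medial axis M_X; consequently 0 ∈ closure(M_X), i.e. the medial axis of the horn reaches its singular point at the origin. -/
open Filter Topology Metric

noncomputable section

/-- The point `(x, y, z)` of Euclidean three-space. -/
def pt3 (x y z : ℝ) : EuclideanSpace ℝ (Fin 3) := (WithLp.equiv 2 (Fin 3 → ℝ)).symm ![x, y, z]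

/-- The horn surface `{x³ = y² + z²} ⊆ ℝ³`. -/
def Horn : Set (EuclideanSpace ℝ (Fin 3)) :=
  {p : EuclideanSpace ℝ (Fin 3) | (p 0) ^ 3 = (p 1) ^ 2 + (p 2) ^ 2}

lemma dist_sq_pt3 (t : ℝ) (p : EuclideanSpace ℝ (Fin 3)) :
    dist (pt3 t 0 0) p ^ 2 = (p 0 - t) ^ 2 + (p 1 ^ 2 + p 2 ^ 2) := by
  rw [EuclideanSpace.dist_eq, Real.sq_sqrt (by positivity)]
  simp [Fin.sum_univ_three, pt3, Real.dist_eq, sq_abs]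
  ring

lemma horn_apply_zero_nonneg {p : EuclideanSpace ℝ (Fin 3)} (hp : p ∈ Horn) : 0 ≤ p 0 := by
  have h : p 0 ^ 3 = p 1 ^ 2 + p 2 ^ 2 := hp
  by_contra! hneg
  have := Odd.pow_neg (n := 3) (by decide) hneg
  nlinarith [sq_nonneg (p 1), sq_nonneg (p 2)]

/-- A point of the horn whose first coordinate `c` is the critical point of
`x ↦ (x - t) ^ 2 + x ^ 3` is nearest to `(t, 0, 0)`. -/
lemma mem_nearestPts_horn {t c : ℝ} (htc : 2 * (c - t) + 3 * c ^ 2 = 0)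
    {q : EuclideanSpace ℝ (Fin 3)} (hq : q ∈ Horn) (hqc : q 0 = c) :
    q ∈ nearestPts Horn (pt3 t 0 0) := by
  have hc : 0 ≤ c := hqc ▸ horn_apply_zero_nonneg hq
  refine ⟨hq, le_antisymm ((le_infDist ⟨q, hq⟩).2 fun p hp => ?_) (infDist_le_dist_of_mem hq)⟩
  refine le_of_sq_le_sq ?_ dist_nonneg
  have hp' : p 0 ^ 3 = p 1 ^ 2 + p 2 ^ 2 := hp
  have hq' : q 0 ^ 3 = q 1 ^ 2 + q 2 ^ 2 := hq
  rw [dist_sq_pt3, dist_sq_pt3, ← hp', ← hq', hqc]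
  have hx := horn_apply_zero_nonneg hp
  have key : 0 ≤ (p 0 - c) ^ 2 * (1 + p 0 + 2 * c) := by positivity
  linear_combination key - (p 0 - c) * htc

lemma pt3_mem_medialAxis_horn {t : ℝ} (ht : 0 < t) : pt3 t 0 0 ∈ medialAxis Horn := by
  obtain ⟨c, hc, htc⟩ : ∃ c : ℝ, 0 < c ∧ 2 * (c - t) + 3 * c ^ 2 = 0 := by
    have hs : √(1 + 6 * t) ^ 2 = 1 + 6 * t := Real.sq_sqrt (by positivity)
    have h1 : 1 < √(1 + 6 * t) := Real.lt_sqrt_of_sq_lt (by linarith)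
    exact ⟨(√(1 + 6 * t) - 1) / 3, by linarith, by linear_combination hs / 3⟩
  have hs : √(c ^ 3) ^ 2 = c ^ 3 := Real.sq_sqrt (by positivity)
  have hpos : 0 < √(c ^ 3) := Real.sqrt_pos.2 (by positivity)
  refine ⟨pt3 c (√(c ^ 3)) 0, mem_nearestPts_horn htc ?_ (by simp [pt3]),
    pt3 c (-√(c ^ 3)) 0, mem_nearestPts_horn htc ?_ (by simp [pt3]), fun h => ?_⟩
  · simp [Horn, pt3, hs]
  · simp [Horn, pt3, hs]
  · have h1 : √(c ^ 3) = -√(c ^ 3) := by simpa [pt3] using congrArg (fun p => p 1) h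
    linarith

/-- for every `t ∈ (0,1)` the point `(t,0,0)` lies on the medial axis of
the horn `{x³ = y² + z²}`; consequently the medial axis reaches the singular point `0`. -/
theorem stmt13 :
    (∀ t : ℝ, 0 < t → t < 1 → pt3 t 0 0 ∈ medialAxis Horn) ∧
    (0 : EuclideanSpace ℝ (Fin 3)) ∈ closure (medialAxis Horn) := by
  refine ⟨fun t ht _ => pt3_mem_medialAxis_horn ht, Metric.mem_closure_iff.2 fun ε hε => ?_⟩
  refine ⟨pt3 (ε / 2) 0 0, pt3_mem_medialAxis_horn (half_pos hε), ?_⟩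
  rw [dist_comm]
  refine lt_of_pow_lt_pow_left₀ 2 hε.le ?_
  rw [dist_sq_pt3]
  simp only [PiLp.zero_apply]
  nlinarith
end
end

section
/- Let X := ({(x, y, z) ∈ ℝ³ : y² + z² ≤ x²} ∪ {(x, y, z) ∈ ℝ³ : x² + z² ≤ y²}) ∩ {(x, y, z) ∈ ℝ³ : |z| ≤ x² + y²}. Then every point (x, y, z) ∈ ℝ³ with |x| = |y|, (x, y) ≠ (0, 0) and z ≠ 0 belongs to the medial axis M_X. -/
open Filter Topology Metric

noncomputable section

/-- The counterexample set
`X = ({y² + z² ≤ x²} ∪ {x² + z² ≤ y²}) ∩ {|z| ≤ x² + y²} ⊆ ℝ³`. -/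
def Xset : Set (EuclideanSpace ℝ (Fin 3)) :=
  ({p : EuclideanSpace ℝ (Fin 3) | (p 1) ^ 2 + (p 2) ^ 2 ≤ (p 0) ^ 2} ∪
    {p : EuclideanSpace ℝ (Fin 3) | (p 0) ^ 2 + (p 2) ^ 2 ≤ (p 1) ^ 2}) ∩
    {p : EuclideanSpace ℝ (Fin 3) | |p 2| ≤ (p 0) ^ 2 + (p 1) ^ 2}

theorem isClosed_Xset : IsClosed Xset := by
  refine ((isClosed_le ?_ ?_).union (isClosed_le ?_ ?_)).inter (isClosed_le ?_ ?_) <;> fun_prop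

theorem dist_sq_fin_three (p q : EuclideanSpace ℝ (Fin 3)) :
    dist p q ^ 2 = (p 0 - q 0) ^ 2 + (p 1 - q 1) ^ 2 + (p 2 - q 2) ^ 2 := by
  rw [EuclideanSpace.dist_eq, Real.sq_sqrt (by positivity), Fin.sum_univ_three]
  simp only [Real.dist_eq, sq_abs]

/-- Reflection of `ℝ³` in the plane `x = σ y`, for `σ = ±1`. -/
def reflectXY (σ : ℝ) (q : EuclideanSpace ℝ (Fin 3)) : EuclideanSpace ℝ (Fin 3) :=
  !₂[σ * q 1, σ * q 0, q 2]

theorem reflectXY_mem_Xset {σ : ℝ} (hσ : σ ^ 2 = 1) {q : EuclideanSpace ℝ (Fin 3)}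
    (hq : q ∈ Xset) : reflectXY σ q ∈ Xset := by
  have hadd := add_comm (q 1 ^ 2) (q 0 ^ 2)
  simp only [Xset, reflectXY, Set.mem_inter_iff, Set.mem_union, Set.mem_ofPred_eq] at hq ⊢
  simp [mul_pow, hσ, hadd]
  exact ⟨hq.1.symm, hq.2⟩

theorem dist_reflectXY {σ : ℝ} (hσ : σ ^ 2 = 1) {p : EuclideanSpace ℝ (Fin 3)}
    (hp : p 1 = σ * p 0) (q : EuclideanSpace ℝ (Fin 3)) :
    dist p (reflectXY σ q) = dist p q := by
  rw [← sq_eq_sq₀ dist_nonneg dist_nonneg, dist_sq_fin_three, dist_sq_fin_three]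
  simp only [reflectXY, PiLp.toLp_apply, Matrix.cons_val, hp]
  linear_combination (q 0 ^ 2 + q 1 ^ 2 - 2 * p 0 * q 0) * hσ

/-- A point with `|x| = |y| ≠ 0` and `z ≠ 0` is closer to `Xset` than to the plane `z = 0`. -/
theorem exists_mem_Xset_dist_sq_lt {σ : ℝ} (hσ : σ ^ 2 = 1) {p : EuclideanSpace ℝ (Fin 3)}
    (hp : p 1 = σ * p 0) (h0 : p 0 ≠ 0) (hz : p 2 ≠ 0) :
    ∃ q ∈ Xset, dist p q ^ 2 < p 2 ^ 2 := by
  obtain ⟨ε, hε, hε1, hεz, hεz2⟩ : ∃ ε : ℝ, 0 < ε ∧ ε ≤ 1 ∧ ε * |p 2| ≤ p 0 ^ 2 ∧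
      ε * p 2 ^ 2 ≤ p 0 ^ 2 := by
    have ha : 0 < p 0 ^ 2 := by positivity
    have hz' : 0 < |p 2| := abs_pos.2 hz
    have hd : 0 < p 0 ^ 2 + p 2 ^ 2 + |p 2| := by positivity
    refine ⟨p 0 ^ 2 / (p 0 ^ 2 + p 2 ^ 2 + |p 2|), by positivity, ?_, ?_, ?_⟩
    · rw [div_le_one hd]; nlinarith [sq_nonneg (p 2)]
    · rw [div_mul_eq_mul_div, div_le_iff₀ hd]; gcongr; nlinarith [sq_nonneg (p 2)]
    · rw [div_mul_eq_mul_div, div_le_iff₀ hd]; gcongr; linarith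
  obtain ⟨t, ht⟩ : ∃ t : ℝ, 4 * p 0 * t = ε ^ 2 * p 2 ^ 2 :=
    ⟨ε ^ 2 * p 2 ^ 2 / (4 * p 0), by field_simp⟩
  refine ⟨!₂[p 0 + t, σ * (p 0 - t), ε * p 2], ⟨Or.inl ?_, ?_⟩, ?_⟩
  · simp only [Set.mem_ofPred_eq, Matrix.cons_val]
    rw [mul_pow, hσ]
    linarith
  · simp only [Set.mem_ofPred_eq, Matrix.cons_val]
    rw [mul_pow, hσ, abs_mul, abs_of_pos hε]
    nlinarith [sq_nonneg t, sq_nonneg (p 0)]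
  · rw [dist_sq_fin_three]
    simp only [Matrix.cons_val, hp]
    have hz2 : 0 < p 2 ^ 2 := by positivity
    have ha : 0 < p 0 ^ 2 := by positivity
    have ht2 : 16 * t ^ 2 ≤ ε * p 2 ^ 2 := by
      have h1 : p 0 ^ 2 * (16 * t ^ 2) = ε ^ 3 * p 2 ^ 2 * (ε * p 2 ^ 2) := by
        linear_combination (4 * p 0 * t + ε ^ 2 * p 2 ^ 2) * ht
      have h2 : ε ^ 3 * p 2 ^ 2 ≤ ε * p 2 ^ 2 := by
        gcongr
        exact pow_le_of_le_one hε.le hε1 (by norm_num)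
      refine le_of_mul_le_mul_left ?_ ha
      rw [h1]
      nlinarith [mul_pos hε hz2]
    have h3 : (σ * p 0 - σ * (p 0 - t)) ^ 2 = t ^ 2 := by
      linear_combination t ^ 2 * hσ
    rw [h3]
    nlinarith [mul_pos hε hz2, mul_nonneg (mul_pos hε hz2).le (sub_nonneg.2 hε1)]

/-- every point `(x,y,z)` with `|x| = |y|`, `(x,y) ≠ (0,0)` and `z ≠ 0`
belongs to the medial axis of `X`. -/
theorem stmt14 (p : EuclideanSpace ℝ (Fin 3))
    (hxy : |p 0| = |p 1|) (hne : ¬(p 0 = 0 ∧ p 1 = 0)) (hz : p 2 ≠ 0) :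
    p ∈ medialAxis Xset := by
  obtain ⟨σ, hσ, hp⟩ : ∃ σ : ℝ, σ ^ 2 = 1 ∧ p 1 = σ * p 0 := by
    rcases abs_eq_abs.1 hxy with h | h
    · exact ⟨1, by norm_num, by linarith⟩
    · exact ⟨-1, by norm_num, by linarith⟩
  have h0 : p 0 ≠ 0 := fun h => hne ⟨h, by rw [hp, h, mul_zero]⟩
  obtain ⟨r, hr, hrlt⟩ := exists_mem_Xset_dist_sq_lt hσ hp h0 hz
  obtain ⟨q, hq, hqd⟩ := isClosed_Xset.exists_infDist_eq_dist ⟨r, hr⟩ p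
  refine ⟨q, ⟨hq, hqd.symm⟩, reflectXY σ q,
    ⟨reflectXY_mem_Xset hσ hq, by rw [dist_reflectXY hσ hp, hqd]⟩, fun hfix => ?_⟩
  have hq0 : q 0 = σ * q 1 := congrArg (fun v : EuclideanSpace ℝ (Fin 3) => v 0) hfix
  have hsq : q 0 ^ 2 = q 1 ^ 2 := by rw [hq0, mul_pow, hσ, one_mul]
  have hq2 : q 2 = 0 := by
    have : q 2 ^ 2 ≤ 0 := by
      rcases hq.1 with h | h <;> simp only [Set.mem_ofPred_eq] at h <;> linarith
    exact pow_eq_zero_iff two_ne_zero |>.1 (le_antisymm this (sq_nonneg _))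
  have hle : dist p q ^ 2 ≤ dist p r ^ 2 := by
    gcongr
    exact hqd ▸ infDist_le_dist_of_mem hr
  rw [dist_sq_fin_three p q, hq2, sub_zero] at hle
  nlinarith [sq_nonneg (p 0 - q 0), sq_nonneg (p 1 - q 1)]
end
end

section
/- Let X := ({(x, y, z) ∈ ℝ³ : y² + z² ≤ x²} ∪ {(x, y, z) ∈ ℝ³ : x² + z² ≤ y²}) ∩ {(x, y, z) ∈ ℝ³ : |z| ≤ x² + y²}. Then for every t ∈ ℝ with |t| ≤ 1/4 one has m((0, 0, t)) = {(0, 0, 0)}; in particular {(0, 0, t) : |t| ≤ 1/4} ∩ M_X = ∅. -/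
open Filter Topology Metric

noncomputable section

theorem dist_pt3_zero_sq (t : ℝ) (p : EuclideanSpace ℝ (Fin 3)) :
    dist (pt3 0 0 t) p ^ 2 = (p 0) ^ 2 + (p 1) ^ 2 + (t - p 2) ^ 2 := by
  rw [EuclideanSpace.dist_sq_eq, Fin.sum_univ_three]
  simp [pt3, Real.dist_eq, sq_abs]

theorem zero_mem_Xset : (0 : EuclideanSpace ℝ (Fin 3)) ∈ Xset := by
  simp [Xset]

theorem dist_pt3_zero_lt {t : ℝ} (ht : |t| ≤ 1 / 4) {p : EuclideanSpace ℝ (Fin 3)}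
    (hp : p ∈ Xset) (hp0 : p ≠ 0) : dist (pt3 0 0 t) 0 < dist (pt3 0 0 t) p := by
  have hz : |p 2| ≤ (p 0) ^ 2 + (p 1) ^ 2 := hp.2
  have hnorm : 0 < (p 0) ^ 2 + (p 1) ^ 2 + (p 2) ^ 2 := by
    have h : 0 < ‖p‖ ^ 2 := by positivity
    rw [EuclideanSpace.norm_sq_eq, Fin.sum_univ_three] at h
    simpa [sq_abs] using h
  have htz : t * p 2 ≤ 1 / 4 * ((p 0) ^ 2 + (p 1) ^ 2) :=
    calc t * p 2 ≤ |t| * |p 2| := by rw [← abs_mul]; exact le_abs_self _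
      _ ≤ _ := by gcongr
  refine lt_of_pow_lt_pow_left₀ 2 dist_nonneg ?_
  rw [dist_pt3_zero_sq, dist_pt3_zero_sq]
  simp only [PiLp.zero_apply]
  nlinarith [sq_nonneg (p 0), sq_nonneg (p 1), sq_nonneg (p 2)]

theorem nearestPts_Xset {t : ℝ} (ht : |t| ≤ 1 / 4) : nearestPts Xset (pt3 0 0 t) = {0} := by
  have hinf : dist (pt3 0 0 t) 0 = infDist (pt3 0 0 t) Xset := by
    refine le_antisymm ((le_infDist ⟨0, zero_mem_Xset⟩).2 fun p hp => ?_)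
      (infDist_le_dist_of_mem zero_mem_Xset)
    rcases eq_or_ne p 0 with rfl | hp0
    · rfl
    · exact (dist_pt3_zero_lt ht hp hp0).le
  ext p
  refine ⟨fun ⟨hp, hd⟩ => ?_, ?_⟩
  · by_contra hp0
    exact (dist_pt3_zero_lt ht hp hp0).ne (hinf.trans hd.symm)
  · rintro rfl
    exact ⟨zero_mem_Xset, hinf⟩

/-- for every `t` with `|t| ≤ 1/4`, the only nearest point of `X` to
`(0,0,t)` is the origin; in particular the segment `{(0,0,t) : |t| ≤ 1/4}` of the
`z`-axis is disjoint from the medial axis of `X`. -/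
theorem stmt15 :
    (∀ t : ℝ, |t| ≤ 1 / 4 → nearestPts Xset (pt3 0 0 t) = {0}) ∧
    (∀ t : ℝ, |t| ≤ 1 / 4 → pt3 0 0 t ∉ medialAxis Xset) := by
  refine ⟨fun t ht => nearestPts_Xset ht, fun t ht => ?_⟩
  rintro ⟨x, hx, y, hy, hxy⟩
  rw [nearestPts_Xset ht] at hx hy
  exact hxy (hx.trans hy.symm)
end
end

section
/- Let X ⊆ ℝⁿ be a nonempty proper closed set, a ∈ X, and let v ∈ ℝⁿ be a unit vector whose directional reaching radius satisfies 0 < ρ := r_v(a) < +∞. Then the open ball B(a + ρv, ρ) is disjoint from X and is a maximal open ball in ℝⁿ ∖ X (it is not a proper subset of any open ball disjoint from X); consequently a + ρv belongs to the central set C_X. -/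
open Filter Topology Metric

noncomputable section

section

variable {E : Type*} [NormedAddCommGroup E] [InnerProductSpace ℝ E]

/-- For a unit vector `v`, the point `w` lies outside the open ball of radius `t` about `t • v`
iff `2 * t * ⟪w, v⟫ ≤ ‖w‖ ^ 2`. -/
theorem le_norm_sub_smul_iff {v : E} (hv : ‖v‖ = 1) (w : E) {t : ℝ} (ht : 0 ≤ t) :
    t ≤ ‖w - t • v‖ ↔ 2 * t * inner ℝ w v ≤ ‖w‖ ^ 2 := by
  have h : ‖w - t • v‖ ^ 2 = ‖w‖ ^ 2 - 2 * t * inner ℝ w v + t ^ 2 := by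
    rw [norm_sub_sq_real, inner_smul_right, norm_smul, hv, Real.norm_eq_abs, abs_of_nonneg ht]
    ring
  rw [← pow_le_pow_iff_left₀ ht (norm_nonneg _) two_ne_zero, h]
  constructor <;> intro h <;> linarith

theorem mem_nearestPts_add_smul_iff {X : Set E} {a v : E} (ha : a ∈ X) (hv : ‖v‖ = 1) {t : ℝ}
    (ht : 0 ≤ t) : a ∈ nearestPts X (a + t • v) ↔ ∀ x ∈ X, t ≤ dist (a + t • v) x := by
  have hd : dist (a + t • v) a = t := by
    simp [dist_eq_norm, norm_smul, hv, abs_of_nonneg ht]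
  constructor
  · rintro ⟨-, h⟩ x hx
    exact (hd.symm.trans h).trans_le (Metric.infDist_le_dist_of_mem hx)
  · intro h
    refine ⟨ha, le_antisymm ?_ (Metric.infDist_le_dist_of_mem ha)⟩
    rw [hd]
    exact (Metric.le_infDist ⟨a, ha⟩).2 fun {x} hx => h x hx

theorem le_dist_of_isLUB {X : Set E} {a v : E} (ha : a ∈ X) (hv : ‖v‖ = 1) {ρ : ℝ} (hρ : 0 < ρ)
    (hlub : IsLUB {t : ℝ | 0 ≤ t ∧ a ∈ nearestPts X (a + t • v)} ρ) {x : E} (hx : x ∈ X) :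
    ρ ≤ dist (a + ρ • v) x := by
  have key : ∀ t : ℝ, dist (a + t • v) x = ‖(x - a) - t • v‖ := fun t => by
    rw [dist_comm, dist_eq_norm, sub_sub]
  rw [key, le_norm_sub_smul_iff hv _ hρ.le]
  rcases le_or_gt (inner ℝ (x - a) v) 0 with hi | hi
  · nlinarith [mul_nonneg hρ.le (neg_nonneg.2 hi), sq_nonneg ‖x - a‖]
  · have hb : ρ ≤ ‖x - a‖ ^ 2 / (2 * inner ℝ (x - a) v) := by
      refine hlub.2 ?_
      rintro t ⟨ht, hm⟩
      have h := (mem_nearestPts_add_smul_iff ha hv ht).1 hm x hx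
      rw [key, le_norm_sub_smul_iff hv _ ht] at h
      rw [le_div_iff₀ (by positivity)]
      linarith
    rw [le_div_iff₀ (by positivity)] at hb
    linarith

theorem dist_add_le_of_ball_subset_ball [Nontrivial E] {p c : E} {ρ r : ℝ} (hρ : 0 < ρ)
    (h : ball p ρ ⊆ ball c r) : dist p c + ρ ≤ r := by
  have hcl : closedBall p ρ ⊆ closedBall c r := by
    rw [← closure_ball p hρ.ne']
    exact (closure_mono h).trans closure_ball_subset_closedBall
  obtain ⟨e, he, hec⟩ : ∃ e : E, ‖e‖ = 1 ∧ p - c = ‖p - c‖ • e := by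
    by_cases h0 : p - c = 0
    · obtain ⟨e, he⟩ := exists_norm_eq E zero_le_one
      exact ⟨e, he, by simp [h0]⟩
    · refine ⟨‖p - c‖⁻¹ • (p - c), norm_smul_inv_norm (𝕜 := ℝ) h0, ?_⟩
      rw [smul_inv_smul₀ (norm_ne_zero_iff.2 h0)]
  have hm : p + ρ • e ∈ closedBall c r := hcl <| by
    simp [norm_smul, he, abs_of_pos hρ]
  have hs : p + ρ • e - c = (‖p - c‖ + ρ) • e := by
    rw [add_smul, ← hec]
    abel
  rwa [mem_closedBall, dist_eq_norm, hs, norm_smul, he, mul_one, Real.norm_eq_abs,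
    abs_of_nonneg (by positivity), ← dist_eq_norm] at hm

end

/-- let `X ⊆ ℝⁿ` be a nonempty proper closed set, `a ∈ X`, and `v` a unit
vector whose directional reaching radius `ρ = r_v(a) = sup{t ≥ 0 : a ∈ m(a + tv)}` is
positive and finite (expressed by `IsLUB`).  Then the open ball `B(a + ρv, ρ)` is
disjoint from `X` and maximal among open balls disjoint from `X`: any open ball
containing it and disjoint from `X` coincides with it.  Hence `a + ρv` is a centre of a
maximal ball, i.e. a point of the central set `C_X`. -/
theorem stmt17 (n : ℕ) (X : Set (EuclideanSpace ℝ (Fin n))) (hne : X.Nonempty)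
    (hprop : X ≠ Set.univ) (hX : IsClosed X)
    (a : EuclideanSpace ℝ (Fin n)) (ha : a ∈ X)
    (v : EuclideanSpace ℝ (Fin n)) (hv : ‖v‖ = 1)
    (ρ : ℝ) (hρ : 0 < ρ)
    (hlub : IsLUB {t : ℝ | 0 ≤ t ∧ a ∈ nearestPts X (a + t • v)} ρ) :
    Metric.ball (a + ρ • v) ρ ∩ X = ∅ ∧
    ∀ (c : EuclideanSpace ℝ (Fin n)) (r : ℝ),
      Metric.ball (a + ρ • v) ρ ⊆ Metric.ball c r → Metric.ball c r ∩ X = ∅ →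
        Metric.ball (a + ρ • v) ρ = Metric.ball c r := by
  have hball : ∀ (c : EuclideanSpace ℝ (Fin n)) (r : ℝ),
      ball c r ∩ X = ∅ ↔ ∀ x ∈ X, r ≤ dist c x := by
    intro c r
    simp only [Set.eq_empty_iff_forall_notMem, Set.mem_inter_iff, mem_ball, not_and', not_lt,
      dist_comm c]
  refine ⟨(hball _ _).2 fun x hx => le_dist_of_isLUB ha hv hρ hlub hx, fun c r hsub hdisj => ?_⟩
  rw [hball] at hdisj
  have : Nontrivial (EuclideanSpace ℝ (Fin n)) :=
    ⟨v, 0, fun h => by simp [h] at hv⟩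
  have hle := dist_add_le_of_ball_subset_ball hρ hsub
  have hra := hdisj a ha
  have hρv : ‖ρ • v‖ = ρ := by rw [norm_smul, hv, mul_one, Real.norm_eq_abs, abs_of_pos hρ]
  obtain ⟨u, rfl⟩ : ∃ u, c = a + ρ • v + u := ⟨c - (a + ρ • v), by abel⟩
  have hpu : dist (a + ρ • v) (a + ρ • v + u) = ‖u‖ := by simp
  have hau : dist (a + ρ • v + u) a = ‖ρ • v + u‖ := by rw [dist_eq_norm]; congr 1; abel
  rw [hpu] at hle
  rw [hau] at hra
  have htri := norm_add_le (ρ • v) u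
  rw [hρv] at htri
  have hray : SameRay ℝ (ρ • v) u := sameRay_iff_norm_add.2 (by rw [hρv]; linarith)
  have hu : u = ‖u‖ • v := by
    have h := hray.norm_smul_eq
    rw [hρv, smul_comm] at h
    exact smul_right_injective _ hρ.ne' h
  have hr : r = ρ + ‖u‖ := by linarith
  have hc : a + ρ • v + u = a + (ρ + ‖u‖) • v := by rw [add_smul, ← hu, add_assoc]
  have hmem : ρ + ‖u‖ ≤ ρ := by
    refine hlub.1 ⟨by positivity, (mem_nearestPts_add_smul_iff ha hv (by positivity)).2 ?_⟩
    rwa [← hc, ← hr]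
  have hu0 : u = 0 := norm_le_zero_iff.1 (by linarith)
  simp [hr, hu0]
end
end
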